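/- Let d ≥ 1, let v ∈ ℝ^d be a unit vector, and let λ₁ > λ₂ > 0. Set q := (1−λ₂/λ₁)/d ∈ (0,1) and define the mixture distribution P_v := (q/2)·δ_{√(dλ₁)·v} + (q/2)·δ_{−√(dλ₁)·v} + (1−q)·N(0, (λ₂/(1−q))·I_d) on ℝ^d. Then: (i) P_v has mean zero; (ii) the covariance of P_v equals Σ_v := (λ₁−λ₂)·vvᵀ + λ₂·I_d, whose top eigenvalue is λ₁ with unit eigenvector v and whose remaining eigenvalues equal λ₂; and (iii) there is a universal constant C > 0 such that for x ∼ P_v, ‖E[(xxᵀ−Σ_v)(xxᵀ−Σ_v)ᵀ]‖₂ ≤ C·d·λ₁². -/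

import Mathlib

open MeasureTheory ProbabilityTheory Real Matrix
open scoped ENNReal NNReal Classical

noncomputable section

/-- Euclidean vectors in `ℝ^d`. -/
abbrev Vec (d : ℕ) : Type := EuclideanSpace ℝ (Fin d)

/-- `d × d` real matrices. -/
abbrev Mat (d : ℕ) : Type := Matrix (Fin d) (Fin d) ℝ

instance matMeasurableSpace {d : ℕ} : MeasurableSpace (Mat d) := MeasurableSpace.pi

/-- The spectral (ℓ₂-operator) norm of a matrix. -/
noncomputable def specNorm {d : ℕ} (A : Mat d) : ℝ :=
  ‖Matrix.toEuclideanCLM (𝕜 := ℝ) A‖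

/-- Matrix-vector multiplication, as a map on Euclidean space. -/
noncomputable def mulVecE {d : ℕ} (A : Mat d) (u : Vec d) : Vec d :=
  Matrix.toEuclideanCLM (𝕜 := ℝ) A u

/-- Reinterpret a Euclidean vector as a plain function. -/
def toVec' {d : ℕ} (u : Vec d) : Fin d → ℝ := u

/-- Real inner product on `ℝ^d`. -/
noncomputable def iprod {d : ℕ} (u v : Vec d) : ℝ := @inner ℝ _ _ u v

/-- Outer product `u vᵀ`. -/
def outer {d : ℕ} (u v : Vec d) : Mat d :=
  Matrix.vecMulVec (toVec' u) (toVec' v)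

/-- Entrywise expectation of a random matrix. -/
noncomputable def matExp {Ω : Type*} [MeasurableSpace Ω] {d : ℕ} (μ : Measure Ω)
    (A : Ω → Mat d) : Mat d :=
  Matrix.of fun i j => ∫ ω, A ω i j ∂μ

/-- The matrix `H_u = lam1⁻² E[(A-Σ) u uᵀ (A-Σ)ᵀ]` of Assumption A.4. -/
noncomputable def Hmat {Ω : Type*} [MeasurableSpace Ω] {d : ℕ} (μ : Measure Ω)
    (A : Ω → Mat d) (Sm : Mat d) (lam1 : ℝ) (u : Vec d) : Mat d :=
  (lam1 ^ 2)⁻¹ • matExp μ fun ω => (A ω - Sm) * outer u u * (A ω - Sm)ᵀ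

/-- `sin²` of the angle between two (nonzero) vectors. -/
noncomputable def sinSq {d : ℕ} (u v : Vec d) : ℝ :=
  1 - iprod u (v) ^ 2 / (‖u‖ ^ 2 * ‖v‖ ^ 2)

/-- `sin` of the angle between two unit vectors. -/
noncomputable def sinU {d : ℕ} (u v : Vec d) : ℝ :=
  Real.sqrt (1 - iprod u (v) ^ 2)

/-- Standard Gaussian measure on `ℝ^d` (as Euclidean space). -/
noncomputable def stdGaussianE (d : ℕ) : Measure (Vec d) :=
  (Measure.pi fun _ : Fin d => gaussianReal 0 1).map (EuclideanSpace.equiv (Fin d) ℝ).symm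

/-- `P` is the centered Gaussian measure with covariance matrix `S`, characterized through its
one-dimensional projections (Cramér–Wold). -/
def IsGaussianMeasure {d : ℕ} (P : Measure (Vec d)) (S : Mat d) : Prop :=
  IsProbabilityMeasure P ∧
    ∀ u : Vec d, P.map (fun x => iprod u (x)) = gaussianReal 0 (iprod u (mulVecE S u)).toNNReal

/-- Two datasets are neighboring if they differ in at most one entry. -/
def Neighboring {n : ℕ} {X : Type*} (S S' : Fin n → X) : Prop :=
  ∃ i₀, ∀ i, i ≠ i₀ → S i = S' i

/-- `(ε,δ)`-differential privacy of a randomized estimator mapping `n` points of `ℝ^d`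
to the unit sphere. -/
def DiffPrivate {n d : ℕ} (M : Kernel (Fin n → Vec d) (Metric.sphere (0 : Vec d) 1))
    (ε δ : ℝ) : Prop :=
  ∀ S S' : Fin n → Vec d, Neighboring S S' →
    ∀ B : Set (Metric.sphere (0 : Vec d) 1), MeasurableSet B →
      M S B ≤ ENNReal.ofReal (Real.exp ε) * M S' B + ENNReal.ofReal δ

/-- Clipping to norm at most `β`. -/
noncomputable def clipV {d : ℕ} (β : ℝ) (x : Vec d) : Vec d :=
  haveI := Classical.propDecidable (x = 0)
  if x = 0 then 0 else (min 1 (β / ‖x‖)) • x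

/-- Covariance (second-moment) matrix of a measure on `ℝ^d`. -/
noncomputable def covMatrix {d : ℕ} (P : Measure (Vec d)) : Mat d :=
  Matrix.of fun i j => ∫ x, toVec' x i * toVec' x j ∂P


noncomputable section

lemma gm_deriv (p p' : ℝ → ℝ) (hp : ∀ t, HasDerivAt p (p' t) t) :
    deriv (fun t => p t * rexp (t ^ 2 / 2)) = fun t => (p' t + t * p t) * rexp (t ^ 2 / 2) := by
  ext t
  have h1 : HasDerivAt (fun t : ℝ => t ^ 2 / 2) t t := by
    have := (hasDerivAt_pow 2 t).div_const 2
    exact this.congr_deriv (by simp)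
  have := ((hp t).mul h1.exp).deriv
  refine Eq.trans this ?_
  ring

lemma gm_iter (n : ℕ) : ∫ x, x ^ n ∂(gaussianReal 0 1)
    = iteratedDeriv n (fun t : ℝ => rexp (t ^ 2 / 2)) 0 := by
  have h := iteratedDeriv_mgf_zero (X := fun x : ℝ => x) (μ := gaussianReal 0 1) (by simp) n
  rw [mgf_fun_id_gaussianReal] at h
  simp only [zero_mul, zero_add, NNReal.coe_one, one_mul] at h
  rw [h]; rfl

lemma gm_d1 : iteratedDeriv 1 (fun t : ℝ => rexp (t ^ 2 / 2)) = fun t => t * rexp (t ^ 2 / 2) := by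
  rw [iteratedDeriv_one]
  have := gm_deriv (fun _ => 1) (fun _ => 0) (fun t => hasDerivAt_const _ _)
  simpa using this

lemma gm_d2 : iteratedDeriv 2 (fun t : ℝ => rexp (t ^ 2 / 2))
    = fun t => (1 + t * t) * rexp (t ^ 2 / 2) := by
  rw [iteratedDeriv_succ, gm_d1]
  exact gm_deriv (fun t => t) (fun _ => 1) (fun t => hasDerivAt_id _)

lemma gm_d3 : iteratedDeriv 3 (fun t : ℝ => rexp (t ^ 2 / 2))
    = fun t => (2 * t + t * (1 + t * t)) * rexp (t ^ 2 / 2) := by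
  rw [iteratedDeriv_succ, gm_d2]
  refine gm_deriv (fun t => 1 + t * t) (fun t => 2 * t) (fun t => ?_)
  have := ((hasDerivAt_id t).mul (hasDerivAt_id t)).const_add 1
  exact this.congr_deriv (by simp; ring)

lemma gm_d4 : iteratedDeriv 4 (fun t : ℝ => rexp (t ^ 2 / 2))
    = fun t => ((3 + 3 * t ^ 2) + t * (2 * t + t * (1 + t * t))) * rexp (t ^ 2 / 2) := by
  rw [iteratedDeriv_succ, gm_d3]
  refine gm_deriv (fun t => 2 * t + t * (1 + t * t)) (fun t => 3 + 3 * t ^ 2) (fun t => ?_)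
  have h1 := ((hasDerivAt_id t).mul (hasDerivAt_id t)).const_add 1
  have := ((hasDerivAt_id t).const_mul 2).add ((hasDerivAt_id t).mul h1)
  exact this.congr_deriv (by simp; ring)

def gm (n : ℕ) : ℝ := ∫ x, x ^ n ∂(gaussianReal 0 1)

lemma gm0 : gm 0 = 1 := by simp [gm]
lemma gm1 : gm 1 = 0 := by rw [gm, gm_iter, gm_d1]; simp
lemma gm2 : gm 2 = 1 := by rw [gm, gm_iter, gm_d2]; simp
lemma gm3 : gm 3 = 0 := by rw [gm, gm_iter, gm_d3]; simp
lemma gm4 : gm 4 = 3 := by rw [gm, gm_iter, gm_d4]; simp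

lemma gm_int (n : ℕ) : Integrable (fun x : ℝ => x ^ n) (gaussianReal 0 1) :=
  integrable_pow_of_mem_interior_integrableExpSet (X := fun x : ℝ => x)
    (by simp) n

lemma std_int_iff {d : ℕ} (f : Vec d → ℝ) (hf : Continuous f) :
    (Integrable f (stdGaussianE d) ↔ Integrable
      (fun x : Fin d → ℝ => f ((EuclideanSpace.equiv (Fin d) ℝ).symm x))
      (Measure.pi fun _ : Fin d => gaussianReal 0 1)) ∧
    ∫ x, f x ∂(stdGaussianE d) = ∫ x : Fin d → ℝ, f ((EuclideanSpace.equiv (Fin d) ℝ).symm x)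
      ∂(Measure.pi fun _ : Fin d => gaussianReal 0 1) := by
  have hm : AEMeasurable (EuclideanSpace.equiv (Fin d) ℝ).symm
      (Measure.pi fun _ : Fin d => gaussianReal 0 1) :=
    (EuclideanSpace.equiv (Fin d) ℝ).symm.continuous.measurable.aemeasurable
  constructor
  · exact integrable_map_measure hf.aestronglyMeasurable hm
  · exact integral_map hm hf.aestronglyMeasurable

instance {d : ℕ} : IsProbabilityMeasure (stdGaussianE d) :=
  Measure.isProbabilityMeasure_map
    (EuclideanSpace.equiv (Fin d) ℝ).symm.continuous.measurable.aemeasurable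

lemma std_mono {d : ℕ} (n : Fin d → ℕ) :
    Integrable (fun x : Vec d => ∏ l, (x l) ^ (n l)) (stdGaussianE d) ∧
    ∫ x : Vec d, ∏ l, (x l) ^ (n l) ∂(stdGaussianE d) = ∏ l, gm (n l) := by
  have h := std_int_iff (fun x : Vec d => ∏ l, (x l) ^ (n l)) (by fun_prop)
  rw [h.1, h.2]
  constructor
  · exact Integrable.fintype_prod (f := fun l (t : ℝ) => t ^ n l) (fun l => gm_int (n l))
  · exact integral_fintype_prod_eq_prod (fun l (t : ℝ) => t ^ n l)

lemma mono_one {d : ℕ} (x : Fin d → ℝ) (i : Fin d) :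
    x i = ∏ l, x l ^ (if l = i then 1 else 0) := by
  simp [Finset.prod_ite_eq', pow_ite]

lemma std1 {d : ℕ} (i : Fin d) : Integrable (fun x : Vec d => x i) (stdGaussianE d) ∧
    ∫ x : Vec d, x i ∂(stdGaussianE d) = 0 := by
  have h := std_mono (fun l : Fin d => if l = i then 1 else 0)
  have e : (fun x : Vec d => x i) = fun x : Vec d => ∏ l, (x l) ^ (if l = i then 1 else 0) := by
    ext x; exact mono_one _ i
  rw [e]
  refine ⟨h.1, h.2.trans ?_⟩
  exact Finset.prod_eq_zero (Finset.mem_univ i) (by simp [gm1])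

lemma std2 {d : ℕ} (i j : Fin d) : Integrable (fun x : Vec d => x i * x j) (stdGaussianE d) ∧
    ∫ x : Vec d, x i * x j ∂(stdGaussianE d) = if i = j then 1 else 0 := by
  have h := std_mono (fun l : Fin d => (if l = i then 1 else 0) + (if l = j then 1 else 0))
  have e : (fun x : Vec d => x i * x j) = fun x : Vec d =>
      ∏ l, (x l) ^ ((if l = i then 1 else 0) + (if l = j then 1 else 0)) := by
    ext x; simp_rw [pow_add, Finset.prod_mul_distrib, ← mono_one]
  rw [e]
  refine ⟨h.1, h.2.trans ?_⟩
  split_ifs with hij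
  · subst hij
    refine Finset.prod_eq_one fun l _ => ?_
    by_cases hl : l = i <;> simp [hl, gm0, gm2]
  · exact Finset.prod_eq_zero (Finset.mem_univ i) (by simp [gm1, hij])

lemma std4 {d : ℕ} (k i j : Fin d) :
    Integrable (fun x : Vec d => x k * x k * (x i * x j)) (stdGaussianE d) ∧
    ∫ x : Vec d, x k * x k * (x i * x j) ∂(stdGaussianE d) =
      if i = j then (1 + 2 * if k = i then 1 else 0) else 0 := by
  have h := std_mono (fun l : Fin d => ((if l = k then 1 else 0) + (if l = k then 1 else 0)) +
    ((if l = i then 1 else 0) + (if l = j then 1 else 0)))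
  have e : (fun x : Vec d => x k * x k * (x i * x j)) = fun x : Vec d =>
      ∏ l, (x l) ^ (((if l = k then 1 else 0) + (if l = k then 1 else 0)) +
    ((if l = i then 1 else 0) + (if l = j then 1 else 0))) := by
    ext x; simp_rw [pow_add, Finset.prod_mul_distrib, ← mono_one]
  rw [e]
  refine ⟨h.1, h.2.trans ?_⟩
  by_cases hij : i = j
  · subst hij
    by_cases hk : k = i
    · subst hk
      rw [Finset.prod_eq_single k]
      · norm_num [gm4]
      · intro b _ hb; simp [hb, gm0]
      · simp
    · simp only [hk, if_true, if_false]
      norm_num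
      refine Finset.prod_eq_one fun l _ => ?_
      by_cases hl : l = i
      · subst hl; simp [Ne.symm hk, gm2]
      · by_cases hl' : l = k <;> simp [hl, hl', gm0, gm2, hk]
  · rw [if_neg hij]
    refine Finset.prod_eq_zero (Finset.mem_univ i) ?_
    by_cases hl' : i = k <;> simp [hl', gm1, gm3, hij]
    · subst hl'; simp [hij, gm3]

def mixP {d : ℕ} (a b s : ℝ) (w : Vec d) : Measure (Vec d) :=
  ENNReal.ofReal a • Measure.dirac w + ENNReal.ofReal a • Measure.dirac (-w) +
    ENNReal.ofReal b • ((stdGaussianE d).map fun x => s • x)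

lemma mix {d : ℕ} {a b s : ℝ} (ha : 0 ≤ a) (hb : 0 ≤ b) (w : Vec d) (f : Vec d → ℝ)
    (hf : Continuous f) (hi : Integrable (fun x => f (s • x)) (stdGaussianE d)) :
    Integrable f (mixP a b s w) ∧ ∫ x, f x ∂(mixP a b s w) =
      a * f w + a * f (-w) + b * ∫ x, f (s • x) ∂(stdGaussianE d) := by
  have hm : AEMeasurable (fun x : Vec d => s • x) (stdGaussianE d) := by fun_prop
  have i1 : ∀ y, Integrable f (ENNReal.ofReal a • Measure.dirac y) := fun y =>
    (integrable_dirac (by simp)).smul_measure ENNReal.ofReal_ne_top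
  have i3 : Integrable f (ENNReal.ofReal b • ((stdGaussianE d).map fun x => s • x)) :=
    ((integrable_map_measure hf.aestronglyMeasurable hm).2 hi).smul_measure ENNReal.ofReal_ne_top
  refine ⟨((i1 _).add_measure (i1 _)).add_measure i3, ?_⟩
  rw [mixP, integral_add_measure ((i1 _).add_measure (i1 _)) i3, integral_add_measure (i1 _) (i1 _),
    integral_smul_measure, integral_smul_measure, integral_smul_measure, integral_dirac,
    integral_dirac, integral_map hm hf.aestronglyMeasurable]
  simp [ENNReal.toReal_ofReal, ha, hb]

lemma mix1 {d : ℕ} {a b s : ℝ} (ha : 0 ≤ a) (hb : 0 ≤ b) (w : Vec d) (i : Fin d) :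
    Integrable (fun x : Vec d => x i) (mixP a b s w) ∧ ∫ x : Vec d, x i ∂(mixP a b s w) = 0 := by
  have h := mix (s := s) ha hb w (fun x => x i) (by fun_prop) (by
    simpa using (std1 i).1.const_mul s)
  refine ⟨h.1, h.2.trans ?_⟩
  simp [integral_const_mul, (std1 i).2]

lemma mix2 {d : ℕ} {a b s : ℝ} (ha : 0 ≤ a) (hb : 0 ≤ b) (w : Vec d) (i j : Fin d) :
    Integrable (fun x : Vec d => x i * x j) (mixP a b s w) ∧
    ∫ x : Vec d, x i * x j ∂(mixP a b s w) = 2 * a * (w i * w j) +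
      b * s ^ 2 * (if i = j then 1 else 0) := by
  have e : (fun x : Vec d => (s • x) i * (s • x) j) = fun x => s ^ 2 * (x i * x j) := by
    ext x; simp; ring
  have h := mix (s := s) ha hb w (fun x => x i * x j) (by fun_prop) (by
    rw [e]; exact (std2 i j).1.const_mul _)
  refine ⟨h.1, h.2.trans ?_⟩
  rw [e, integral_const_mul, (std2 i j).2]
  simp; ring

lemma mix4 {d : ℕ} {a b s : ℝ} (ha : 0 ≤ a) (hb : 0 ≤ b) (w : Vec d) (k i j : Fin d) :
    Integrable (fun x : Vec d => x k * x k * (x i * x j)) (mixP a b s w) ∧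
    ∫ x : Vec d, x k * x k * (x i * x j) ∂(mixP a b s w) = 2 * a * (w k * w k * (w i * w j)) +
      b * s ^ 4 * (if i = j then (1 + 2 * if k = i then 1 else 0) else 0) := by
  have e : (fun x : Vec d => (s • x) k * (s • x) k * ((s • x) i * (s • x) j)) =
      fun x => s ^ 4 * (x k * x k * (x i * x j)) := by
    ext x; simp; ring
  have h := mix (s := s) ha hb w (fun x => x k * x k * (x i * x j)) (by fun_prop) (by
    rw [e]; exact (std4 k i j).1.const_mul _)
  refine ⟨h.1, h.2.trans ?_⟩
  rw [e, integral_const_mul, (std4 k i j).2]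
  simp; ring

lemma mixProb {d : ℕ} {a b s : ℝ} (ha : 0 ≤ a) (hb : 0 ≤ b) (hab : 2 * a + b = 1) (w : Vec d) :
    IsProbabilityMeasure (mixP a b s w) := by
  have hm : AEMeasurable (fun x : Vec d => s • x) (stdGaussianE d) := by fun_prop
  have := Measure.isProbabilityMeasure_map hm
  constructor
  simp only [mixP, Measure.add_apply, Measure.smul_apply, measure_univ, smul_eq_mul, mul_one]
  rw [← ENNReal.ofReal_add ha ha, ← ENNReal.ofReal_add (by linarith) hb]
  rw [← ENNReal.ofReal_one]; congr 1; linarith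

lemma matExp_eq {d : ℕ} (P : Measure (Vec d)) [IsProbabilityMeasure P] (S : Mat d)
    (h2 : ∀ i j, Integrable (fun x : Vec d => x i * x j) P)
    (h4 : ∀ k i j, Integrable (fun x : Vec d => x k * x k * (x i * x j)) P)
    (hS : ∀ i j, ∫ x : Vec d, x i * x j ∂P = S i j) (i j : Fin d) :
    (matExp P fun x => (outer x x - S) * (outer x x - S)ᵀ) i j =
      (∑ k, ∫ x : Vec d, x k * x k * (x i * x j) ∂P) - (S * Sᵀ) i j := by
  have e : ∀ x : Vec d, ((outer x x - S) * (outer x x - S)ᵀ) i j =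
      ∑ k, (x k * x k * (x i * x j) - S j k * (x i * x k) - S i k * (x j * x k) + S i k * S j k) := by
    intro x
    simp only [Matrix.mul_apply, outer, Matrix.sub_apply, Matrix.transpose_apply, vecMulVec_apply, toVec']
    refine Finset.sum_congr rfl fun k _ => ?_
    ring
  simp only [matExp, Matrix.of_apply, e]
  have I1 : ∀ k, Integrable (fun x : Vec d => x k * x k * (x i * x j) - S j k * (x i * x k)) P :=
    fun k => (h4 k i j).sub ((h2 i k).const_mul _)
  have I2 : ∀ k, Integrable (fun x : Vec d => x k * x k * (x i * x j) - S j k * (x i * x k)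
      - S i k * (x j * x k)) P := fun k => (I1 k).sub ((h2 j k).const_mul _)
  have I3 : ∀ k, Integrable (fun x : Vec d => x k * x k * (x i * x j) - S j k * (x i * x k)
      - S i k * (x j * x k) + S i k * S j k) P := fun k => (I2 k).add (integrable_const _)
  rw [integral_finsetSum _ (fun k _ => I3 k), Matrix.mul_apply,
    ← Finset.sum_sub_distrib]
  refine Finset.sum_congr rfl fun k _ => ?_
  rw [integral_add (I2 k) (integrable_const _), integral_sub (I1 k) ((h2 j k).const_mul _),
    integral_sub (h4 k i j) ((h2 i k).const_mul _), integral_const_mul, integral_const_mul, hS, hS]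
  simp
  ring

lemma outer_mulVec {d : ℕ} (v u : Vec d) : mulVecE (outer v v) u = iprod u v • v := by
  ext i
  simp [mulVecE, outer, iprod, toVec', Matrix.ofLp_toEuclideanCLM, Matrix.vecMulVec, Matrix.mulVec,
    dotProduct, PiLp.inner_apply, Finset.sum_mul]
  refine Finset.sum_congr rfl fun k _ => ?_
  ring

lemma mulVecE_SP {d : ℕ} (a b : ℝ) (v u : Vec d) :
    mulVecE (a • outer v v + b • (1 : Mat d)) u = (a * iprod u v) • v + b • u := by
  have := outer_mulVec v u
  simp only [mulVecE] at *
  rw [map_add, map_smul, map_smul, map_one]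
  simp [this, smul_smul]

lemma specNorm_SP {d : ℕ} (a b : ℝ) (v : Vec d) (hv : ‖v‖ = 1) :
    specNorm (a • outer v v + b • (1 : Mat d)) ≤ |a| + |b| := by
  refine ContinuousLinearMap.opNorm_le_bound _ (by positivity) fun u => ?_
  have := mulVecE_SP a b v u
  rw [mulVecE] at this
  rw [this]
  refine (norm_add_le _ _).trans ?_
  rw [norm_smul, norm_smul, hv, norm_mul]
  have h : ‖iprod u v‖ ≤ ‖u‖ := by
    have := norm_inner_le_norm (𝕜 := ℝ) u v
    rwa [hv, mul_one] at this
  simp only [Real.norm_eq_abs] at *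
  have := mul_le_mul_of_nonneg_left h (abs_nonneg a)
  nlinarith

lemma SP_symm {d : ℕ} (a b : ℝ) (v : Vec d) :
    (a • outer v v + b • (1 : Mat d))ᵀ = a • outer v v + b • (1 : Mat d) := by
  ext i j
  simp [outer, vecMulVec_apply, Matrix.one_apply, eq_comm, mul_comm]

end

/-- the hard-instance construction of Theorem C.1 (Appendix C.3),
with its covariance and second-moment computations. -/
theorem statement_15 :
    ∃ C : ℝ, 0 < C ∧
      ∀ (d : ℕ) (v : Vec d) (lam1 lam2 : ℝ), 1 ≤ d → ‖v‖ = 1 → 0 < lam2 → lam2 < lam1 →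
        (let q : ℝ := (1 - lam2 / lam1) / d
         let P : Measure (Vec d) :=
           ENNReal.ofReal (q / 2) • Measure.dirac (Real.sqrt ((d : ℝ) * lam1) • v) +
             ENNReal.ofReal (q / 2) • Measure.dirac (-(Real.sqrt ((d : ℝ) * lam1) • v)) +
             ENNReal.ofReal (1 - q) •
               ((stdGaussianE d).map fun x => Real.sqrt (lam2 / (1 - q)) • x)
         let SP : Mat d := (lam1 - lam2) • outer v v + lam2 • (1 : Mat d)
         -- (i) mean zero
         (∫ x, x ∂P) = 0 ∧
           -- (ii) covariance Σ_v with its spectral structure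
           covMatrix P = SP ∧
           mulVecE SP v = lam1 • v ∧
           (∀ u : Vec d, iprod u v = 0 → mulVecE SP u = lam2 • u) ∧
           -- (iii) second-moment bound
           specNorm (matExp P fun x => (outer x x - SP) * (outer x x - SP)ᵀ) ≤
             C * d * lam1 ^ 2) := by
  refine ⟨10, by norm_num, ?_⟩
  intro d v lam1 lam2 hd hv h2 h12 q P SP
  have hd' : (1 : ℝ) ≤ d := by exact_mod_cast hd
  have h1 : 0 < lam1 := h2.trans h12
  have hr1 : lam2 / lam1 < 1 := (div_lt_one h1).2 h12
  have hr0 : 0 < lam2 / lam1 := by positivity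
  have hqd : q * d = 1 - lam2 / lam1 := by
    simp only [q]; field_simp
  have hq0 : 0 ≤ q := by
    simp only [q]; apply div_nonneg <;> linarith
  have hq1 : lam2 / lam1 ≤ 1 - q := by
    nlinarith
  have hq1' : 0 < 1 - q := by linarith
  have hqdl : q * (d * lam1) = lam1 - lam2 := by
    rw [← mul_assoc, hqd]; field_simp
  have hP : P = mixP (q / 2) (1 - q) (√(lam2 / (1 - q))) (√(d * lam1) • v) := rfl
  have ha : 0 ≤ q / 2 := by linarith
  have hs2 : √(lam2 / (1 - q)) ^ 2 = lam2 / (1 - q) := Real.sq_sqrt (by positivity)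
  have hs4 : √(lam2 / (1 - q)) ^ 4 = (lam2 / (1 - q)) ^ 2 := by
    rw [show √(lam2 / (1 - q)) ^ 4 = (√(lam2 / (1 - q)) ^ 2) ^ 2 by ring, hs2]
  have ht2 : √(d * lam1) * √(d * lam1) = d * lam1 := Real.mul_self_sqrt (by positivity)
  have hcov : ∀ i j, ∫ x : Vec d, x i * x j ∂P = SP i j := by
    intro i j
    rw [hP, (mix2 ha hq1'.le _ i j).2, hs2]
    simp only [SP, outer, toVec', PiLp.smul_apply, smul_eq_mul, Matrix.add_apply,
      Matrix.smul_apply, vecMulVec_apply, Matrix.one_apply]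
    have : (1 - q) * (lam2 / (1 - q)) = lam2 := by field_simp
    rw [this]
    linear_combination (q * v i * v j) * ht2 + (v i * v j) * hqdl
  have : IsProbabilityMeasure P := by
    rw [hP]; exact mixProb ha hq1'.le (by ring) _
  have hvv : iprod v v = 1 := by simp [iprod, hv]
  have hvs : ∑ k, v k * v k = 1 := by
    rw [← hvv, iprod, PiLp.inner_apply]; rfl
  refine ⟨?_, ?_, ?_, ?_, ?_⟩
  · ext i
    rw [eval_integral_piLp (fun i => ?_)]
    · rw [hP]; exact (mix1 ha hq1'.le _ i).2
    · rw [hP]; exact (mix1 ha hq1'.le _ i).1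
  · ext i j
    exact hcov i j
  · rw [mulVecE_SP, hvv, ← add_smul]; congr 1; ring
  · intro u hu
    rw [mulVecE_SP, hu]; simp
  · set B : ℝ := (1 - q) * (lam2 / (1 - q)) ^ 2 * (d + 2) with hB
    have hM : (matExp P fun x => (outer x x - SP) * (outer x x - SP)ᵀ) =
        ((lam1 - lam2) * (d * lam1)) • outer v v + B • (1 : Mat d) - SP * SP := by
      ext i j
      rw [matExp_eq P SP (fun i j => by rw [hP]; exact (mix2 ha hq1'.le _ i j).1)
        (fun k i j => by rw [hP]; exact (mix4 ha hq1'.le _ k i j).1) hcov, Matrix.sub_apply, SP_symm]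
      congr 1
      rw [hP]
      simp_rw [(mix4 ha hq1'.le _ _ i j).2]
      rw [Finset.sum_add_distrib, ← Finset.mul_sum, ← Finset.mul_sum]
      simp only [Matrix.add_apply, Matrix.smul_apply, outer, toVec', vecMulVec_apply,
        Matrix.one_apply, smul_eq_mul, PiLp.smul_apply]
      congr 1
      · rw [← Finset.sum_mul]
        have : ∑ k, √(d * lam1) * v k * (√(d * lam1) * v k) = d * lam1 := by
          refine Eq.trans ?_ (mul_one (d * lam1))
          rw [← hvs, Finset.mul_sum]
          refine Finset.sum_congr rfl fun k _ => ?_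
          linear_combination (v k * v k) * ht2
        rw [this]
        linear_combination (q * d * lam1 * v i * v j) * ht2 + (d * lam1 * v i * v j) * hqdl
      · rw [hs4]
        split_ifs with hij
        · simp [Finset.sum_add_distrib, hB]
        · simp
    rw [hM]
    have hSP : specNorm SP ≤ lam1 := by
      refine (specNorm_SP _ _ v hv).trans ?_
      rw [abs_of_pos h2, abs_of_pos (by linarith)]; linarith
    have hB0 : 0 ≤ B := by positivity
    have hB1 : B ≤ 3 * d * lam1 ^ 2 := by
      have e1 : (1 - q) * (lam2 / (1 - q)) ^ 2 = lam2 * (lam2 / (1 - q)) := by field_simp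
      have e2 : lam2 / (1 - q) ≤ lam1 := by
        rw [div_le_iff₀ hq1']
        rw [div_le_iff₀ h1] at hq1
        linarith
      have e3 : lam2 * (lam2 / (1 - q)) ≤ lam1 * lam1 := by
        apply mul_le_mul h12.le e2 (by positivity) h1.le
      rw [hB, e1]
      calc _ ≤ lam1 * lam1 * (3 * d) := by
            apply mul_le_mul e3 (by linarith) (by positivity) (by positivity)
        _ = _ := by ring
    have hA : specNorm (((lam1 - lam2) * (d * lam1)) • outer v v + B • (1 : Mat d)) ≤
        4 * d * lam1 ^ 2 := by
      refine (specNorm_SP _ _ v hv).trans ?_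
      have : 0 ≤ lam2 * (d * lam1) := by positivity
      rw [abs_of_nonneg hB0, abs_of_nonneg (mul_nonneg (by linarith) (by positivity))]
      nlinarith
    have hSS : specNorm (SP * SP) ≤ lam1 * lam1 := by
      unfold specNorm at hSP ⊢
      rw [map_mul]
      refine (norm_mul_le _ _).trans ?_
      exact mul_le_mul hSP hSP (norm_nonneg _) h1.le
    have hsub : specNorm (((lam1 - lam2) * (d * lam1)) • outer v v + B • (1 : Mat d) - SP * SP)
        ≤ specNorm (((lam1 - lam2) * (d * lam1)) • outer v v + B • (1 : Mat d))
          + specNorm (SP * SP) := by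
      unfold specNorm
      rw [map_sub]
      exact norm_sub_le _ _
    have : lam1 * lam1 ≤ d * lam1 ^ 2 := by nlinarith [sq_nonneg lam1]
    have : 0 ≤ d * lam1 ^ 2 := by positivity
    linarith
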